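/- Combining the two reductions: for A, B ∈ ℝ^{N×d}, the expected optimal least-squares error for fitting a random Gaussian linear function of the rows of A by a linear function of the rows of B equals the reconstruction error of A from B by the best linear map, i.e., E_{u ~ N(0,I_d)}[ min_v ∑_j (uᵀa_j − vᵀb_j)² ] = min_{W ∈ ℝ^{d×d}} ∑_j ‖a_j − W b_j‖₂². -/

import Mathlib

open Matrix MeasureTheory ProbabilityTheory
open scoped BigOperators

lemma exists_ls {N d : ℕ} (f : Fin N → ℝ) (b : Fin N → Fin d → ℝ) :
    ∃ w : Fin d → ℝ, ∀ v : Fin d → ℝ, ∑ j, (f j - w ⬝ᵥ b j) * (v ⬝ᵥ b j) = 0 := by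
  let L : (Fin d → ℝ) →ₗ[ℝ] EuclideanSpace ℝ (Fin N) :=
    { toFun := fun v => WithLp.toLp 2 (fun j => v ⬝ᵥ b j)
      map_add' := by intro x y; ext j; simp [add_dotProduct]
      map_smul' := by intro c x; ext j; simp [smul_dotProduct] }
  let K := LinearMap.range L
  obtain ⟨w, hw⟩ : K.starProjection (WithLp.toLp 2 f) ∈ LinearMap.range L :=
    K.starProjection_apply_mem _
  refine ⟨w, fun v => ?_⟩
  have h := K.starProjection_inner_eq_zero (WithLp.toLp 2 f) (L v) ⟨v, rfl⟩
  rw [← hw] at h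
  simp only [PiLp.inner_apply] at h
  simpa [L, mul_comm] using h

lemma ls_iInf {N d : ℕ} (r : Fin N → ℝ) (b : Fin N → Fin d → ℝ) (f : Fin N → ℝ) (w : Fin d → ℝ)
    (hr : ∀ j, r j = f j - w ⬝ᵥ b j)
    (h : ∀ v : Fin d → ℝ, ∑ j, r j * (v ⬝ᵥ b j) = 0) (v : Fin d → ℝ) :
    ∑ j, (r j) ^ 2 ≤ ∑ j, (f j - v ⬝ᵥ b j) ^ 2 := by
  have e : ∑ j, (f j - v ⬝ᵥ b j) ^ 2 =
      ∑ j, (r j) ^ 2 + 2 * ∑ j, r j * ((w - v) ⬝ᵥ b j) + ∑ j, ((w - v) ⬝ᵥ b j) ^ 2 := by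
    rw [Finset.mul_sum, ← Finset.sum_add_distrib, ← Finset.sum_add_distrib]
    refine Finset.sum_congr rfl fun j _ => ?_
    rw [hr, sub_dotProduct]; ring
  rw [e, h]
  have : 0 ≤ ∑ j, ((w - v) ⬝ᵥ b j) ^ 2 := Finset.sum_nonneg fun _ _ => sq_nonneg _
  linarith

lemma memLp_dot {d : ℕ} (r : Fin d → ℝ) :
    MemLp (fun u : Fin d → ℝ => u ⬝ᵥ r) 2 (Measure.pi fun _ : Fin d => gaussianReal 0 1) := by
  simp only [dotProduct]
  refine memLp_finsetSum _ fun i _ => ?_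
  have h : MemLp (fun x : ℝ => x * r i) 2 (gaussianReal 0 1) :=
    (memLp_id_gaussianReal 2).mul_const (r i)
  exact h.comp_measurePreserving (measurePreserving_eval (fun _ : Fin d => gaussianReal 0 1) i)

lemma integral_dot {d : ℕ} (r : Fin d → ℝ) :
    ∫ u : Fin d → ℝ, (u ⬝ᵥ r) ^ 2 ∂(Measure.pi fun _ : Fin d => gaussianReal 0 1) =
      ∑ i, r i ^ 2 := by
  have hm : ∀ i : Fin d, MemLp (fun x : ℝ => x * r i) 2 (gaussianReal 0 1) := fun i =>
    (memLp_id_gaussianReal 2).mul_const (r i)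
  have hfun : (∑ i, fun u : Fin d → ℝ => u i * r i) = fun u => u ⬝ᵥ r := by
    ext u; simp [dotProduct]
  have hv := variance_sum_pi (μ := fun _ : Fin d => gaussianReal 0 1)
    (X := fun i x => x * r i) hm
  rw [hfun] at hv
  have hz : ∫ u : Fin d → ℝ, u ⬝ᵥ r ∂(Measure.pi fun _ : Fin d => gaussianReal 0 1) = 0 := by
    simp only [dotProduct]
    rw [integral_finsetSum]
    · refine Finset.sum_eq_zero fun i _ => ?_
      rw [integral_mul_const,
        integral_comp_eval (μ := fun _ : Fin d => gaussianReal 0 1) (i := i) (f := fun x : ℝ => x)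
          (by fun_prop)]
      simp
    · intro i _
      exact ((hm i).comp_measurePreserving
        (measurePreserving_eval (fun _ : Fin d => gaussianReal 0 1) i)).integrable (by norm_num)
  rw [variance_of_integral_eq_zero (memLp_dot r).aemeasurable hz] at hv
  rw [hv]
  refine Finset.sum_congr rfl fun i _ => ?_
  rw [variance_mul_const]
  simp

/-- `E_{u ~ N(0,I_d)}[min_v ∑_j (uᵀa_j - vᵀb_j)²]
  = min_{W ∈ ℝ^{d×d}} ∑_j ‖a_j - W b_j‖₂²`. -/
theorem stmt8 {N d : ℕ} (a b : Fin N → Fin d → ℝ) :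
    ∫ u : Fin d → ℝ, (⨅ v : Fin d → ℝ, ∑ j, (u ⬝ᵥ a j - v ⬝ᵥ b j) ^ 2)
        ∂(Measure.pi fun _ : Fin d => gaussianReal 0 1) =
      ⨅ W : Matrix (Fin d) (Fin d) ℝ, ∑ j, ∑ i, (a j i - W.mulVec (b j) i) ^ 2 := by
  choose w hw using fun i : Fin d => exists_ls (fun j => a j i) b
  let R : Fin N → Fin d → ℝ := fun j i => a j i - w i ⬝ᵥ b j
  have hR : ∀ i v, ∑ j, R j i * (v ⬝ᵥ b j) = 0 := hw
  have hL : ∀ u : Fin d → ℝ, (⨅ v : Fin d → ℝ, ∑ j, (u ⬝ᵥ a j - v ⬝ᵥ b j) ^ 2) =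
      ∑ j, (u ⬝ᵥ R j) ^ 2 := by
    intro u
    have hr : ∀ j, u ⬝ᵥ R j = u ⬝ᵥ a j - (u ᵥ* Matrix.of w) ⬝ᵥ b j := by
      intro j
      rw [← dotProduct_mulVec, ← dotProduct_sub]
      rfl
    have ho : ∀ v : Fin d → ℝ, ∑ j, (u ⬝ᵥ R j) * (v ⬝ᵥ b j) = 0 := by
      intro v
      have : ∑ j, (u ⬝ᵥ R j) * (v ⬝ᵥ b j) = ∑ i, u i * ∑ j, R j i * (v ⬝ᵥ b j) := by
        simp_rw [Finset.mul_sum]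
        rw [Finset.sum_comm]
        refine Finset.sum_congr rfl fun j _ => ?_
        rw [dotProduct, Finset.sum_mul]
        exact Finset.sum_congr rfl fun i _ => by ring
      rw [this]
      simp [hR]
    apply le_antisymm
    · refine (ciInf_le ⟨0, ?_⟩ (u ᵥ* Matrix.of w)).trans_eq ?_
      · rintro _ ⟨v, rfl⟩
        exact Finset.sum_nonneg fun _ _ => sq_nonneg _
      · simp [hr]
    · exact le_ciInf fun v => ls_iInf _ b _ _ hr ho v
  have hRt : (⨅ W : Matrix (Fin d) (Fin d) ℝ, ∑ j, ∑ i, (a j i - W.mulVec (b j) i) ^ 2) =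
      ∑ j, ∑ i, R j i ^ 2 := by
    apply le_antisymm
    · refine (ciInf_le ⟨0, ?_⟩ (Matrix.of w)).trans_eq rfl
      rintro _ ⟨v, rfl⟩
      exact Finset.sum_nonneg fun _ _ => Finset.sum_nonneg fun _ _ => sq_nonneg _
    · refine le_ciInf fun W => ?_
      rw [Finset.sum_comm, Finset.sum_comm (f := fun j i => (a j i - W.mulVec (b j) i) ^ 2)]
      exact Finset.sum_le_sum fun i _ =>
        ls_iInf (fun j => R j i) b (fun j => a j i) (w i) (fun _ => rfl) (hR i) (W i)
  rw [hRt]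
  simp_rw [hL]
  rw [integral_finsetSum _ fun j _ => (memLp_dot (R j)).integrable_sq]
  exact Finset.sum_congr rfl fun j _ => integral_dot (R j)
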